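/- arXiv:math/0204210 — 3 statements merged into one kernel-verified Lean document; each statement's English description precedes it below -/
import Mathlib

section
/- Let n ≥ 1, let R be a commutative ring containing an element ζ that is a root of the n-th cyclotomic polynomial Φ_n over ℤ, let G be a cyclic group of order n with fixed generator τ, and let M be a finite R[G]-module. Then [M] · ∏_{i=0}^{n-1} [Ĥ⁰_{χ^i}(G,M) / S_{χ^i}(M)] = ∏_{i=0}^{n-1} [M^{χ^i}]. -/
noncomputable section

open Polynomial

variable {R : Type*} [CommRing R] {M : Type*} [AddCommGroup M] [Module R M]

/-- The isotypic component `M^{χ^i} = {m : τ m = ζ^i m}` of the module `M`, where the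
generator `τ` of the cyclic group acts via the `R`-linear endomorphism `T` and
`ζ` is the chosen root of unity. -/
def isoComp (T : Module.End R M) (ζ : R) (i : ℕ) : Submodule R M :=
  LinearMap.ker (T - ζ ^ i • (1 : Module.End R M))

/-- The quasi-idempotent `ε_{χ^i} = ∑_{j<n} ζ^{-ij} τ^j`, acting on `M`.  Here
`ζ⁻¹ = ζ^{n-1}` since `ζ^n = 1`. -/
def quasiIdem (T : Module.End R M) (ζ : R) (n i : ℕ) : Module.End R M :=
  ∑ j ∈ Finset.range n, ζ ^ ((n - 1) * (i * j)) • T ^ j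

/-- The product `P_i = ∏_{j=i+1}^{n-1} (τ - ζ^j)`, acting on `M`. -/
def tailProd (T : Module.End R M) (ζ : R) (n i : ℕ) : Module.End R M :=
  Polynomial.aeval T (∏ j ∈ Finset.Ico (i + 1) n, (X - C (ζ ^ j)))

/-- `Ĥ⁰_{χ^i}(G, M) = M^{χ^i} / ε_{χ^i} M`. -/
abbrev H0chi (T : Module.End R M) (ζ : R) (n i : ℕ) :=
  ↥(isoComp T ζ i) ⧸
    Submodule.comap (isoComp T ζ i).subtype (LinearMap.range (quasiIdem T ζ n i))

/-- `S_{χ^i}(M) = (M^{χ^i} ∩ P_i M) / ε_{χ^i} M`, a submodule of `Ĥ⁰_{χ^i}(G, M)`. -/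
def Schi (T : Module.End R M) (ζ : R) (n i : ℕ) : Submodule R (H0chi T ζ n i) :=
  Submodule.map
    (Submodule.mkQ
      (Submodule.comap (isoComp T ζ i).subtype (LinearMap.range (quasiIdem T ζ n i))))
    (Submodule.comap (isoComp T ζ i).subtype (LinearMap.range (tailProd T ζ n i)))

/-- A root of `Φ_n` satisfies every integral polynomial relation satisfied by a primitive complex
`n`-th root of unity. -/
theorem aeval_eq_zero_of_aeval_cyclotomic_eq_zero {A : Type*} [CommRing A] {n : ℕ} (hn : 0 < n)
    {a : A} (ha : aeval a (cyclotomic n ℤ) = 0) {μ : ℂ} (hμ : IsPrimitiveRoot μ n) {p : ℤ[X]}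
    (hp : aeval μ p = 0) : aeval a p = 0 := by
  have hdvd : cyclotomic n ℤ ∣ p := by
    rw [cyclotomic_eq_minpoly hμ hn]
    exact minpoly.isIntegrallyClosed_dvd (hμ.isIntegral hn) hp
  obtain ⟨q, rfl⟩ := hdvd
  rw [map_mul, ha, zero_mul]

theorem IsPrimitiveRoot.prod_range_X_sub_C_pow {A : Type*} [CommRing A] [IsDomain A] {n : ℕ}
    (hn : 0 < n) {μ : A} (hμ : IsPrimitiveRoot μ n) :
    ∏ j ∈ Finset.range n, (X - C (μ ^ j)) = X ^ n - 1 := by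
  classical
  rw [X_pow_sub_one_eq_prod hn hμ]
  refine Finset.prod_bij (fun j _ => μ ^ j) (fun j _ => ?_) (fun i hi j hj h => ?_)
    (fun b hb => ?_) (fun _ _ => rfl)
  · rw [Polynomial.mem_nthRootsFinset hn, ← pow_mul, mul_comm, pow_mul, hμ.pow_eq_one, one_pow]
  · exact hμ.pow_inj (Finset.mem_range.1 hi) (Finset.mem_range.1 hj) h
  · have : NeZero n := ⟨hn.ne'⟩
    obtain ⟨i, hi, h⟩ := hμ.eq_pow_of_pow_eq_one ((Polynomial.mem_nthRootsFinset hn _).1 hb)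
    exact ⟨i, Finset.mem_range.2 hi, h⟩

theorem prod_range_X_sub_C_pow_of_aeval_cyclotomic {A : Type*} [CommRing A] {n : ℕ} (hn : 0 < n)
    {a : A} (ha : aeval a (cyclotomic n ℤ) = 0) :
    ∏ j ∈ Finset.range n, (X - C (a ^ j)) = X ^ n - 1 := by
  let F : ℤ[X][X] := ∏ j ∈ Finset.range n, (X - C (X ^ j)) - (X ^ n - 1)
  have hFa : F.map (aeval a : ℤ[X] →ₐ[ℤ] A).toRingHom =
      ∏ j ∈ Finset.range n, (X - C (a ^ j)) - (X ^ n - 1) := by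
    simp [F, Polynomial.map_prod]
  have hFμ : ∀ μ : ℂ, F.map (aeval μ : ℤ[X] →ₐ[ℤ] ℂ).toRingHom =
      ∏ j ∈ Finset.range n, (X - C (μ ^ j)) - (X ^ n - 1) := by
    intro μ
    simp [F, Polynomial.map_prod]
  have hμ := Complex.isPrimitiveRoot_exp n hn.ne'
  rw [← sub_eq_zero, ← hFa]
  ext k
  have h := congrArg (fun p => p.coeff k) (hFμ (Complex.exp (2 * Real.pi * Complex.I / n)))
  simp only [hμ.prod_range_X_sub_C_pow hn, sub_self, coeff_zero, coeff_map] at h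
  rw [coeff_map, coeff_zero]
  exact aeval_eq_zero_of_aeval_cyclotomic_eq_zero hn ha hμ h

theorem pow_eq_one_of_aeval_cyclotomic_eq_zero {A : Type*} [CommRing A] {n : ℕ}
    {a : A} (ha : aeval a (cyclotomic n ℤ) = 0) : a ^ n = 1 := by
  obtain ⟨q, hq⟩ := cyclotomic.dvd_X_pow_sub_one n ℤ
  have h := congrArg (aeval a) hq
  rw [map_mul, ha, zero_mul] at h
  simpa [sub_eq_zero] using h

/-- If `a ^ n = 1`, then up to the unit `a ^ i` the geometric sum in `a ^ ((n - 1) * i) * X` is the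
cofactor of `X - a ^ i` in `X ^ n - 1`. -/
theorem X_sub_C_pow_mul_geom_sum {A : Type*} [CommRing A] {n : ℕ} (hn : 0 < n) {a : A}
    (ha : a ^ n = 1) (i : ℕ) :
    (X - C (a ^ i)) * ∑ j ∈ Finset.range n, C (a ^ ((n - 1) * (i * j))) * X ^ j =
      C (a ^ i) * (X ^ n - 1) := by
  set b := a ^ ((n - 1) * i) with hb
  have hab : a ^ i * b = 1 := by
    rw [hb, ← pow_add, add_comm, ← Nat.succ_mul, Nat.succ_eq_add_one, Nat.sub_add_cancel hn,
      pow_mul, ha, one_pow]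
  have hbn : b ^ n = 1 := by
    rw [hb, ← pow_mul, mul_comm, pow_mul, ha, one_pow]
  have hsum : ∑ j ∈ Finset.range n, C (a ^ ((n - 1) * (i * j))) * X ^ j =
      ∑ j ∈ Finset.range n, (C b * X) ^ j := by
    refine Finset.sum_congr rfl fun j _ => ?_
    rw [mul_pow, ← C_pow, hb, ← pow_mul, mul_assoc]
  have hX : (X - C (a ^ i) : A[X]) = C (a ^ i) * (C b * X - 1) := by
    rw [mul_sub, ← mul_assoc, ← C_mul, hab, C_1, one_mul, mul_one]
  rw [hsum, hX, mul_assoc, mul_geom_sum, mul_pow, ← C_pow, hbn, C_1, one_mul]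

theorem quasiIdem_eq_aeval (T : Module.End R M) (ζ : R) (n i : ℕ) :
    quasiIdem T ζ n i =
      aeval T (∑ j ∈ Finset.range n, C (ζ ^ ((n - 1) * (i * j))) * X ^ j) := by
  simp only [quasiIdem, map_sum, map_mul, aeval_X_pow, aeval_C, Algebra.smul_def]

theorem range_quasiIdem_le_range_tailProd (T : Module.End R M) {ζ : R} {n i : ℕ} (hi : i < n)
    (hζ : aeval ζ (cyclotomic n ℤ) = 0) :
    LinearMap.range (quasiIdem T ζ n i) ≤ LinearMap.range (tailProd T ζ n i) := by
  have hn : 0 < n := by omega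
  have hsplit : ∏ j ∈ Finset.range n, (X - C (ζ ^ j)) =
      (X - C (ζ ^ i)) * ((∏ j ∈ Finset.Ico (i + 1) n, (X - C (ζ ^ j))) *
        ∏ j ∈ Finset.range i, (X - C (ζ ^ j))) := by
    rw [← Finset.prod_range_mul_prod_Ico _ hi.le, Finset.prod_eq_prod_Ico_succ_bot hi]
    ring
  have h := X_sub_C_pow_mul_geom_sum hn (pow_eq_one_of_aeval_cyclotomic_eq_zero hζ) i
  rw [← prod_range_X_sub_C_pow_of_aeval_cyclotomic hn hζ, hsplit, mul_left_comm] at h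
  have h' := (monic_X_sub_C (ζ ^ i)).isRegular.left h
  rw [quasiIdem_eq_aeval, h', mul_left_comm, map_mul]
  exact LinearMap.range_comp_le_range _ _

theorem card_isoComp_inf_mul_card_map [Finite M] (T : Module.End R M) (ζ : R) (i : ℕ)
    (N : Submodule R M) :
    Nat.card (N.comap (isoComp T ζ i).subtype) *
      Nat.card (N.map (T - ζ ^ i • (1 : Module.End R M))) = Nat.card N := by
  set D := T - ζ ^ i • (1 : Module.End R M)
  have e := (D.domRestrict N).quotKerEquivRange.toEquiv
  have hker : Nat.card (LinearMap.ker (D.domRestrict N)) =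
      Nat.card (N.comap (isoComp T ζ i).subtype) :=
    Nat.card_congr
      { toFun := fun x => ⟨⟨x.1.1, x.2⟩, x.1.2⟩
        invFun := fun x => ⟨⟨x.1.1, x.2⟩, x.1.2⟩
        left_inv := fun _ => rfl
        right_inv := fun _ => rfl }
  have hrange : LinearMap.range (D.domRestrict N) = N.map D := LinearMap.range_domRestrict N D
  rw [Submodule.card_eq_card_quotient_mul_card (LinearMap.ker (D.domRestrict N)), hker,
    Nat.card_congr e, hrange]

theorem card_H0chi_quotient_Schi_mul [Finite M] (T : Module.End R M) {ζ : R} {n i : ℕ}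
    (h : LinearMap.range (quasiIdem T ζ n i) ≤ LinearMap.range (tailProd T ζ n i)) :
    Nat.card (H0chi T ζ n i ⧸ Schi T ζ n i) *
      Nat.card ((LinearMap.range (tailProd T ζ n i)).comap (isoComp T ζ i).subtype) =
      Nat.card (isoComp T ζ i) := by
  rw [Submodule.card_eq_card_quotient_mul_card
      ((LinearMap.range (tailProd T ζ n i)).comap (isoComp T ζ i).subtype), mul_comm]
  congr 1
  exact Nat.card_congr
    (Submodule.quotientQuotientEquivQuotient _ _ (Submodule.comap_mono h)).toEquiv

theorem prod_card_isoComp_inf_range_tailProd [Finite M] (T : Module.End R M) (ζ : R) (n : ℕ) :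
    (∏ i ∈ Finset.range n,
      Nat.card ((LinearMap.range (tailProd T ζ n i)).comap (isoComp T ζ i).subtype)) *
      Nat.card (LinearMap.range (aeval T (∏ j ∈ Finset.range n, (X - C (ζ ^ j))))) =
      Nat.card M := by
  let Q : ℕ → Submodule R M := fun i =>
    LinearMap.range (aeval T (∏ j ∈ Finset.Ico i n, (X - C (ζ ^ j))))
  have hstep : ∀ i < n, Nat.card ((Q (i + 1)).comap (isoComp T ζ i).subtype) * Nat.card (Q i) =
      Nat.card (Q (i + 1)) := by
    intro i hi
    rw [← card_isoComp_inf_mul_card_map T ζ i (Q (i + 1))]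
    have hQ : Q i = (Q (i + 1)).map (T - ζ ^ i • (1 : Module.End R M)) := by
      simp only [Q]
      rw [Finset.prod_eq_prod_Ico_succ_bot hi, map_mul, Module.End.mul_eq_comp,
        LinearMap.range_comp, map_sub, aeval_X, aeval_C, Algebra.algebraMap_eq_smul_one]
    rw [hQ]
  have key : ∀ k ≤ n, (∏ i ∈ Finset.range k,
      Nat.card ((Q (i + 1)).comap (isoComp T ζ i).subtype)) * Nat.card (Q 0) =
        Nat.card (Q k) := by
    intro k
    induction k with
    | zero => simp
    | succ k ih =>
      intro hk
      rw [Finset.prod_range_succ, mul_right_comm, ih (by omega), mul_comm, hstep k hk]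
  have hQn : Nat.card (Q n) = Nat.card M := by
    simp only [Q, Finset.Ico_self, Finset.prod_empty, map_one, Module.End.one_eq_id,
      LinearMap.range_id]
    exact Nat.card_congr Submodule.topEquiv.toEquiv
  have h := key n le_rfl
  rw [hQn] at h
  simpa only [Q, Finset.range_eq_Ico, tailProd] using h

/-- **Theorem 2.1.** For a cyclic group `G` of order `n` with generator `τ` (encoded as an
`R`-linear endomorphism `T` of `M` with `T^n = 1`), a commutative ring `R` containing a root
`ζ` of the `n`-th cyclotomic polynomial, and a finite `R[G]`-module `M`:
`[M] ⬝ ∏_i [Ĥ⁰_{χ^i}(G,M)/S_{χ^i}(M)] = ∏_i [M^{χ^i}]`. -/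
theorem order_mul_prod_H0_div_S_eq_prod_isotypic
    (n : ℕ) (hn : 1 ≤ n) (R : Type*) [CommRing R] (ζ : R)
    (hζ : Polynomial.aeval ζ (Polynomial.cyclotomic n ℤ) = 0)
    (M : Type*) [AddCommGroup M] [Module R M] [Finite M]
    (T : Module.End R M) (hT : T ^ n = 1) :
    Nat.card M *
        ∏ i ∈ Finset.range n, Nat.card (H0chi T ζ n i ⧸ Schi T ζ n i) =
      ∏ i ∈ Finset.range n, Nat.card (isoComp T ζ i) := by
  have hle : ∀ i ∈ Finset.range n,
      LinearMap.range (quasiIdem T ζ n i) ≤ LinearMap.range (tailProd T ζ n i) :=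
    fun i hi => range_quasiIdem_le_range_tailProd T (Finset.mem_range.1 hi) hζ
  have hM := prod_card_isoComp_inf_range_tailProd T ζ n
  rw [prod_range_X_sub_C_pow_of_aeval_cyclotomic hn hζ, map_sub, map_pow, aeval_X, hT, map_one,
    sub_self, LinearMap.range_zero, Nat.card_unique, mul_one] at hM
  rw [← hM, ← Finset.prod_mul_distrib]
  refine Finset.prod_congr rfl fun i hi => ?_
  rw [mul_comm, card_H0chi_quotient_Schi_mul T (hle i hi)]
end
end

section
/- Let n ≥ 1 and let G be a cyclic group of order 2^n with fixed generator τ; let τ₀ = τ^{2^{n-1}} be the unique element of G of order 2. Let R be a commutative ring containing an element ζ that is a root of the 2^n-th cyclotomic polynomial over ℤ, and let M be a finite R[G]-module such that M⁺ := {m ∈ M : τ₀·m = m} equals (1 + τ₀)·M. Then [M] = ∏_{i=0}^{2^n-1} [M^{χ^i}] = ∏_{i=0}^{2^n-1} [ε_{χ^i}M]. -/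
noncomputable section

open Polynomial

variable {R : Type*} [CommRing R] {M : Type*} [AddCommGroup M] [Module R M]

/-- If the kernels and images of `1 ± T ^ h` match up, where `2 * h` is a power of two, then every
fixed vector of `T` lies in the image of the norm `∑_{j < 2 * h} T ^ j`. -/
theorem ker_sub_one_le_range_geom_sum (T : Module.End R M) (k h : ℕ) (hk : 2 * h = 2 ^ k)
    (hker_sub : LinearMap.ker (T ^ h - 1) ≤ LinearMap.range (1 + T ^ h))
    (hker_add : LinearMap.ker (1 + T ^ h) ≤ LinearMap.range (T ^ h - 1)) :
    LinearMap.ker (T - 1) ≤ LinearMap.range (∑ j ∈ Finset.range (2 * h), T ^ j) := by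
  set S : Module.End R M := ∑ j ∈ Finset.range h, T ^ j with hS
  set E : Module.End R M := ∑ j ∈ Finset.range (2 * h), T ^ j with hE
  have hES : E = (1 + T ^ h) * S := by
    rw [hE, two_mul, Finset.sum_range_add, hS, add_mul, one_mul, Finset.mul_sum]
    simp only [pow_add]
  have hTS : (T - 1) * S = T ^ h - 1 := mul_geom_sum T h
  have hcomm : (T - 1) * (1 + T ^ h) = (1 + T ^ h) * (T - 1) := by
    have := (Commute.refl T).pow_right h
    simp only [mul_add, add_mul, sub_mul, mul_sub, one_mul, mul_one, this.eq]
    abel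
  have hpow : ∀ m : M, T m = m → ∀ j, (T ^ j) m = m := by
    intro m hm j
    induction j with
    | zero => simp
    | succ j ih => rw [pow_succ, Module.End.mul_apply, hm, ih]
  have hstep : ∀ m : M, T m = m → ∃ w m', T m' = m' ∧ m = E w + 2 • m' := by
    intro m hm
    obtain ⟨y, hy⟩ := hker_sub (show m ∈ LinearMap.ker (T ^ h - 1) by simp [hpow m hm h])
    obtain ⟨w, hw⟩ := hker_add (show (T - 1) y ∈ LinearMap.ker (1 + T ^ h) by
      rw [LinearMap.mem_ker, ← Module.End.mul_apply, ← hcomm, Module.End.mul_apply, hy]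
      simp [hm])
    have hfix : T (y - S w) = y - S w := by
      rw [← hTS, Module.End.mul_apply] at hw
      have : (T - 1) (y - S w) = 0 := by rw [map_sub, hw, sub_self]
      simpa [sub_eq_zero] using this
    refine ⟨w, y - S w, hfix, ?_⟩
    have h2 : (1 + T ^ h) (y - S w) = 2 • (y - S w) := by
      rw [LinearMap.add_apply, hpow _ hfix h, Module.End.one_apply, two_smul]
    rw [← h2, hES, Module.End.mul_apply, ← map_add, add_sub_cancel, hy]
  have hiter : ∀ r, ∀ m : M, T m = m → ∃ w m', T m' = m' ∧ m = E w + 2 ^ r • m' := by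
    intro r
    induction r with
    | zero => exact fun m hm => ⟨0, m, hm, by simp⟩
    | succ r ih =>
      intro m hm
      obtain ⟨w, m', hm', rfl⟩ := ih m hm
      obtain ⟨w', m'', hm'', h'⟩ := hstep m' hm'
      refine ⟨w + 2 ^ r • w', m'', hm'', ?_⟩
      rw [map_add, map_nsmul, add_assoc, pow_succ, mul_smul, ← smul_add, ← h']
  intro m hm
  obtain ⟨w, m', hm', rfl⟩ := hiter k m (by simpa [sub_eq_zero] using hm)
  refine ⟨w + m', ?_⟩
  have : E m' = 2 ^ k • m' := by
    rw [hE, LinearMap.sum_apply, Finset.sum_congr rfl fun j _ => hpow m' hm' j]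
    simp [hk]
  rw [map_add, this]

/-- The order of a module is the product of the orders of the kernel and the image of a linear
map. -/
theorem card_eq_card_ker_mul_card_range {M' : Type*} [AddCommGroup M'] [Module R M']
    (f : M →ₗ[R] M') :
    Nat.card M = Nat.card (LinearMap.ker f) * Nat.card (LinearMap.range f) := by
  rw [Submodule.card_eq_card_quotient_mul_card (LinearMap.ker f),
    Nat.card_congr f.quotKerEquivRange.toEquiv]

/-- For a finite module, `ker f = im g` and `f ∘ g = 0 = g ∘ f` force `ker g = im f`. -/
theorem ker_le_range_of_ker_eq_range [Finite M] (f g : Module.End R M) (hgf : g * f = 0)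
    (h : LinearMap.ker f = LinearMap.range g) : LinearMap.ker g ≤ LinearMap.range f := by
  have hle : LinearMap.range f ≤ LinearMap.ker g := by
    rintro _ ⟨x, rfl⟩
    rw [LinearMap.mem_ker, ← Module.End.mul_apply, hgf, LinearMap.zero_apply]
  have hcard : Nat.card (LinearMap.ker g) = Nat.card (LinearMap.range f) := by
    have h1 := card_eq_card_ker_mul_card_range f
    rw [card_eq_card_ker_mul_card_range g, h, mul_comm] at h1
    exact Nat.eq_of_mul_eq_mul_left Nat.card_pos h1
  have heq : (LinearMap.range f : Set M) = LinearMap.ker g :=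
    Set.eq_of_subset_of_ncard_le hle (le_of_eq hcard) (Set.toFinite _)
  exact heq.ge

/-- A root of unity `ζ` with `ζ ^ 2 ^ k = -1` gives the full factorization of
`x ^ 2 ^ (k + 1) - 1`. -/
theorem prod_sub_pow_eq_pow_sub_one {A : Type*} [CommRing A] (k : ℕ) (x ζ : A)
    (hζ : ζ ^ 2 ^ k = -1) :
    ∏ j ∈ Finset.range (2 ^ (k + 1)), (x - ζ ^ j) = x ^ 2 ^ (k + 1) - 1 := by
  induction k generalizing x ζ with
  | zero =>
    have : ζ = -1 := by simpa using hζ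
    subst this
    simp [Finset.prod_range_succ]
    ring
  | succ k ih =>
    have h2 : 2 ^ (k + 1 + 1) = 2 ^ (k + 1) + 2 ^ (k + 1) := by ring
    rw [h2, Finset.prod_range_add, ← Finset.prod_mul_distrib]
    have : ∀ j ∈ Finset.range (2 ^ (k + 1)),
        (x - ζ ^ j) * (x - ζ ^ (2 ^ (k + 1) + j)) = x ^ 2 - (ζ ^ 2) ^ j := by
      intro j _
      rw [pow_add, hζ, ← pow_mul, mul_comm 2 j, pow_mul]
      ring
    rw [Finset.prod_congr rfl this, ih (x ^ 2) (ζ ^ 2) (by rw [← pow_mul, ← pow_succ', hζ])]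
    ring

/-- If `∏ p i` kills a finite module and each `ker (p i)` lies in the image of the product of the
other factors, then the order of the module is the product of the orders of the kernels. -/
theorem card_eq_prod_card_ker_aeval [Finite M] (T : Module.End R M) (p : ℕ → R[X]) (N : ℕ)
    (hzero : aeval T (∏ i ∈ Finset.range N, p i) = 0)
    (hle : ∀ i ∈ Finset.range N, LinearMap.ker (aeval T (p i)) ≤
      LinearMap.range (aeval T (∏ j ∈ (Finset.range N).erase i, p j))) :
    Nat.card M = ∏ i ∈ Finset.range N, Nat.card (LinearMap.ker (aeval T (p i))) := by
  have main : ∀ k ≤ N, Nat.card (LinearMap.range (aeval T (∏ j ∈ Finset.Ico k N, p j))) =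
      ∏ i ∈ Finset.range k, Nat.card (LinearMap.ker (aeval T (p i))) := by
    intro k
    induction k with
    | zero =>
      intro _
      rw [← Finset.range_eq_Ico, hzero, LinearMap.range_zero]
      simp
    | succ k ih =>
      intro hk
      rw [Finset.prod_range_succ, ← ih (by lia), Finset.prod_eq_prod_Ico_succ_bot hk]
      set P := ∏ j ∈ Finset.Ico (k + 1) N, p j
      have hker : LinearMap.ker (aeval T (p k)) ≤ LinearMap.range (aeval T P) := by
        refine (hle k (Finset.mem_range.mpr hk)).trans ?_
        have hsub : Finset.Ico (k + 1) N ⊆ (Finset.range N).erase k := by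
          intro j hj
          simp only [Finset.mem_Ico, Finset.mem_erase, Finset.mem_range] at hj ⊢
          lia
        rw [← Finset.prod_sdiff hsub, mul_comm, map_mul]
        exact LinearMap.range_comp_le_range _ _
      have hrange : LinearMap.range (aeval T (p k * P)) =
          LinearMap.range ((aeval T (p k)).domRestrict (LinearMap.range (aeval T P))) := by
        rw [map_mul, Module.End.mul_eq_comp, LinearMap.range_comp, LinearMap.range_domRestrict]
      rw [hrange, mul_comm, card_eq_card_ker_mul_card_range
        ((aeval T (p k)).domRestrict (LinearMap.range (aeval T P))), LinearMap.ker_domRestrict,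
        Nat.card_congr (Submodule.comapSubtypeEquivOfLe hker).toEquiv]
  have h := main N le_rfl
  rw [Finset.Ico_self, Finset.prod_empty, map_one] at h
  rw [← h, Module.End.one_eq_id, LinearMap.range_id]
  simp

/-- **Corollary 4.11.** Let `G` be cyclic of order `2^n` (`n ≥ 1`) with generator `τ`
(encoded as `T` with `T^{2^n} = 1`), let `τ₀ = τ^{2^{n-1}}` be the unique element of order
`2`, let `R` contain a root `ζ` of the `2^n`-th cyclotomic polynomial, and let `M` be a
finite `R[G]`-module with `M⁺ = {m : τ₀ m = m} = (1 + τ₀) M`.  Then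
`[M] = ∏_i [M^{χ^i}] = ∏_i [ε_{χ^i} M]`. -/
theorem order_eq_prod_isotypic_of_plus_part_eq_norm
    (n : ℕ) (hn : 1 ≤ n) (R : Type*) [CommRing R] (ζ : R)
    (hζ : Polynomial.aeval ζ (Polynomial.cyclotomic (2 ^ n) ℤ) = 0)
    (M : Type*) [AddCommGroup M] [Module R M] [Finite M]
    (T : Module.End R M) (hT : T ^ 2 ^ n = 1)
    (hplus : LinearMap.ker (T ^ 2 ^ (n - 1) - (1 : Module.End R M)) =
      LinearMap.range ((1 : Module.End R M) + T ^ 2 ^ (n - 1))) :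
    Nat.card M = ∏ i ∈ Finset.range (2 ^ n), Nat.card (isoComp T ζ i) ∧
      Nat.card M =
        ∏ i ∈ Finset.range (2 ^ n), Nat.card (LinearMap.range (quasiIdem T ζ (2 ^ n) i)) := by
  obtain ⟨k, rfl⟩ : ∃ k, n = k + 1 := ⟨n - 1, by lia⟩
  rw [Nat.add_sub_cancel] at hplus
  have hneg : ζ ^ 2 ^ k = -1 := by
    rw [cyclotomic_prime_pow_eq_geom_sum Nat.prime_two] at hζ
    simp [Finset.sum_range_succ] at hζ
    exact eq_neg_of_add_eq_zero_right hζ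
  have hone : ζ ^ 2 ^ (k + 1) = 1 := by rw [pow_succ, pow_mul, hneg]; norm_num
  set N := 2 ^ (k + 1) with hN
  have hN2 : 2 * 2 ^ k = N := by rw [hN, pow_succ, mul_comm]
  have hTT : (T ^ 2 ^ k) * (T ^ 2 ^ k) = 1 := by rw [← pow_add, ← two_mul, hN2, hT]
  have hminus : LinearMap.ker (1 + T ^ 2 ^ k) ≤ LinearMap.range (T ^ 2 ^ k - 1) :=
    ker_le_range_of_ker_eq_range _ _ (by
      rw [add_mul, one_mul, mul_sub, hTT, mul_one]
      abel) hplus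
  have hquasi : ∀ i, quasiIdem T ζ N i =
      ∑ j ∈ Finset.range N, (ζ ^ ((N - 1) * i) • T) ^ j := by
    intro i
    refine Finset.sum_congr rfl fun j _ => ?_
    rw [_root_.smul_pow, ← pow_mul, mul_assoc]
  have hinv : ∀ i, ζ ^ i * ζ ^ ((N - 1) * i) = 1 := by
    intro i
    have hpos : 1 + (N - 1) = N := Nat.add_sub_cancel' Nat.one_le_two_pow
    rw [← pow_add]
    nth_rewrite 1 [← one_mul i]
    rw [← add_mul, hpos, pow_mul, hone, one_pow]
  have hiso : ∀ i, T - ζ ^ i • (1 : Module.End R M) =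
      ζ ^ i • (ζ ^ ((N - 1) * i) • T - 1) := by
    intro i
    rw [smul_sub, smul_smul, hinv, one_smul]
  have hle : ∀ i, isoComp T ζ i ≤ LinearMap.range (quasiIdem T ζ N i) := by
    intro i
    have hker : isoComp T ζ i ≤ LinearMap.ker (ζ ^ ((N - 1) * i) • T - 1) := by
      intro m hm
      rw [isoComp, hiso, LinearMap.mem_ker, LinearMap.smul_apply] at hm
      rw [LinearMap.mem_ker]
      have h := congrArg (ζ ^ ((N - 1) * i) • ·) hm
      rwa [smul_smul, mul_comm, hinv, one_smul, smul_zero] at h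
    refine hker.trans ?_
    rw [hquasi, ← hN2]
    have hc : (ζ ^ ((2 * 2 ^ k - 1) * i) • T) ^ 2 ^ k = T ^ 2 ^ k ∨
        (ζ ^ ((2 * 2 ^ k - 1) * i) • T) ^ 2 ^ k = -T ^ 2 ^ k := by
      rw [_root_.smul_pow, ← pow_mul, mul_comm _ (2 ^ k), pow_mul, hneg]
      rcases neg_one_pow_eq_or R ((2 * 2 ^ k - 1) * i) with h | h <;> simp [h]
    apply ker_sub_one_le_range_geom_sum _ (k + 1) _ hN2
    · rcases hc with h | h <;> rw [h]
      · exact hplus.le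
      · rw [← neg_add', LinearMap.ker_neg, add_comm, ← sub_eq_add_neg, ← neg_sub,
          LinearMap.range_neg]
        exact hminus
    · rcases hc with h | h <;> rw [h]
      · exact hminus
      · rw [← neg_add', LinearMap.range_neg, ← sub_eq_add_neg, ← neg_sub, LinearMap.ker_neg,
          add_comm]
        exact hplus.le
  have hge : ∀ i, LinearMap.range (quasiIdem T ζ N i) ≤ isoComp T ζ i := by
    rintro i _ ⟨x, rfl⟩
    rw [isoComp, LinearMap.mem_ker, ← Module.End.mul_apply, hquasi, hiso, smul_mul_assoc,
      mul_geom_sum, _root_.smul_pow, hT, ← pow_mul, mul_comm _ N, pow_mul, hone]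
    simp
  have heq : ∀ i, LinearMap.range (quasiIdem T ζ N i) = isoComp T ζ i :=
    fun i => le_antisymm (hge i) (hle i)
  have hfactor : ∏ j ∈ Finset.range N, (X - C (ζ ^ j)) = (X : R[X]) ^ N - 1 := by
    simp only [C_pow]
    exact prod_sub_pow_eq_pow_sub_one k X (C ζ) (by rw [← C_pow, hneg]; simp)
  have haeval : ∀ i, aeval T (X - C (ζ ^ i)) = T - ζ ^ i • (1 : Module.End R M) := by
    intro i
    rw [map_sub, aeval_X, aeval_C, Algebra.algebraMap_eq_smul_one]
  have hquasi_prod : ∀ i ∈ Finset.range N, quasiIdem T ζ N i =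
      ζ ^ i • aeval T (∏ j ∈ (Finset.range N).erase i, (X - C (ζ ^ j))) := by
    intro i hi
    have hpoly : ∑ j ∈ Finset.range N, (C (ζ ^ ((N - 1) * i)) * X) ^ j =
        C (ζ ^ i) * ∏ j ∈ (Finset.range N).erase i, (X - C (ζ ^ j)) := by
      apply (monic_X_sub_C (ζ ^ i)).isRegular.left
      have hX : X - C (ζ ^ i) = C (ζ ^ i) * (C (ζ ^ ((N - 1) * i)) * X - 1) := by
        rw [mul_sub, ← mul_assoc, ← C_mul, hinv, C_1, one_mul, mul_one]
      change (X - C (ζ ^ i)) * _ = (X - C (ζ ^ i)) * _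
      rw [mul_left_comm, Finset.mul_prod_erase _ (fun j => X - C (ζ ^ j)) hi, hfactor, hX,
        mul_assoc, mul_geom_sum, mul_pow, ← C_pow, ← pow_mul, mul_comm _ N, pow_mul, hone]
      simp
    have := congrArg (aeval T) hpoly
    rw [map_mul, aeval_C, ← Algebra.smul_def] at this
    rw [← this, hquasi]
    simp [Algebra.smul_def]
  have hcard : Nat.card M = ∏ i ∈ Finset.range N, Nat.card (isoComp T ζ i) := by
    rw [card_eq_prod_card_ker_aeval T (fun i => X - C (ζ ^ i)) N]
    · simp only [haeval, isoComp]
    · rw [hfactor]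
      simp [hT]
    · intro i hi
      rw [haeval]
      refine (hle i).trans ?_
      rw [hquasi_prod i hi]
      rintro _ ⟨x, rfl⟩
      exact ⟨ζ ^ i • x, by simp⟩
  refine ⟨hcard, ?_⟩
  simp only [heq]
  exact hcard
end
end

section
/- Let K/F be a finite abelian extension of number fields with Galois group G of exponent e, let R = ℤ[X]/(Φ_e) with ζ the class of X, and let C̄_K = R ⊗_ℤ C_K, an R[G]-module. Then there exist positive integers a and b, each divisible only by primes dividing e, such that a · h_K^{φ(e)} = b · h_F^{φ(e)} · ∏_{χ ∈ Ĝ, χ ≠ 1} [ε_χ C̄_K], where φ is Euler's totient function. -/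
set_option synthInstance.maxHeartbeats 400000
set_option maxHeartbeats 1000000

open NumberField Polynomial TensorProduct
open scoped nonZeroDivisors

/-- The ring `R = ℤ[X]/(Φ_e) ≅ ℤ[ζ_e]`. -/
abbrev CycQuotRing (e : ℕ) : Type :=
  Polynomial ℤ ⧸ Ideal.span {Polynomial.cyclotomic e ℤ}

/-- The class `ζ` of `X` in `ℤ[X]/(Φ_e)`. -/
noncomputable def zetaCyc (e : ℕ) : CycQuotRing e :=
  Ideal.Quotient.mk _ (X : Polynomial ℤ)

/-- The extension of scalars `C̄_K = R ⊗_ℤ C_K` of the ideal class group, as an `R`-module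
(the class group written additively). -/
abbrev barClassGroup (e : ℕ) (A : Type*) [CommGroup A] : Type _ :=
  CycQuotRing e ⊗[ℤ] Additive A

/-- The `R`-linear endomorphism of `C̄_K = R ⊗_ℤ C_K` induced by an endomorphism of `C_K`. -/
noncomputable def barEnd (e : ℕ) {A : Type*} [CommGroup A] (f : A →* A) :
    Module.End (CycQuotRing e) (barClassGroup e A) :=
  LinearMap.baseChange (CycQuotRing e) (MonoidHom.toAdditive f).toIntLinearMap

/-- The quasi-idempotent `ε_χ = ∑_{σ ∈ G} χ(σ)⁻¹ σ` acting on `C̄_K`, for a character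
`χ : G → R^×` whose values are `e`-th roots of unity (so `χ(σ)⁻¹ = χ(σ)^{e-1}`). -/
noncomputable def epsBar (e : ℕ) {A : Type*} [CommGroup A] {G : Type*} [Group G]
    (act : G → (A →* A)) (χ : G →* CycQuotRing e) :
    Module.End (CycQuotRing e) (barClassGroup e A) :=
  ∑ᶠ σ : G, χ σ ^ (e - 1) • barEnd e (act σ)

/-- `x` and `y` agree up to positive factors supported at the primes dividing `e`. -/
def EqUpToPrimesOf (e x y : ℕ) : Prop :=
  ∃ a b : ℕ, 0 < a ∧ 0 < b ∧ (∀ q : ℕ, q.Prime → q ∣ a → q ∣ e) ∧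
    (∀ q : ℕ, q.Prime → q ∣ b → q ∣ e) ∧ a * x = b * y

theorem EqUpToPrimesOf.symm {e x y : ℕ} (h : EqUpToPrimesOf e x y) : EqUpToPrimesOf e y x := by
  obtain ⟨a, b, ha, hb, ha', hb', h⟩ := h
  exact ⟨b, a, hb, ha, hb', ha', h.symm⟩

theorem EqUpToPrimesOf.trans {e x y z : ℕ} (h : EqUpToPrimesOf e x y)
    (h' : EqUpToPrimesOf e y z) : EqUpToPrimesOf e x z := by
  obtain ⟨a, b, ha, hb, ha', hb', h⟩ := h
  obtain ⟨c, d, hc, hd, hc', hd', h'⟩ := h'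
  refine ⟨a * c, b * d, Nat.mul_pos ha hc, Nat.mul_pos hb hd, fun q hq hd => ?_,
    fun q hq hd => ?_, ?_⟩
  · exact (hq.dvd_mul.mp hd).elim (ha' q hq) (hc' q hq)
  · exact (hq.dvd_mul.mp hd).elim (hb' q hq) (hd' q hq)
  · calc a * c * x = c * (a * x) := by ring
      _ = b * (c * y) := by rw [h]; ring
      _ = b * d * z := by rw [h']; ring

theorem EqUpToPrimesOf.mul_right {e x y : ℕ} (h : EqUpToPrimesOf e x y) (z : ℕ) :
    EqUpToPrimesOf e (x * z) (y * z) := by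
  obtain ⟨a, b, ha, hb, ha', hb', h⟩ := h
  exact ⟨a, b, ha, hb, ha', hb', by rw [← mul_assoc, h, mul_assoc]⟩

theorem Nat.Prime.dvd_of_dvd_card_of_nsmul_eq_zero {A : Type*} [AddGroup A] [Finite A] {m q : ℕ}
    (hA : ∀ x : A, m • x = 0) (hq : q.Prime) (h : q ∣ Nat.card A) : q ∣ m := by
  have := Fact.mk hq
  obtain ⟨x, hx⟩ := exists_prime_addOrderOf_dvd_card' q h
  exact hx ▸ addOrderOf_dvd_of_nsmul_eq_zero (hA x)

/-- A homomorphism whose kernel and cokernel are killed by `m` preserves the cardinality up to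
factors supported at the primes dividing `m`. -/
theorem AddMonoidHom.eqUpToPrimesOf_card {M N : Type*} [AddCommGroup M] [AddCommGroup N]
    [Finite M] [Finite N] (f : M →+ N) {e m : ℕ} (hm : ∀ q : ℕ, q.Prime → q ∣ m → q ∣ e)
    (hker : ∀ x, f x = 0 → m • x = 0) (hcoker : ∀ y, ∃ x, f x = m • y) :
    EqUpToPrimesOf e (Nat.card M) (Nat.card N) := by
  refine ⟨Nat.card (N ⧸ f.range), Nat.card f.ker, Nat.card_pos, Nat.card_pos,
    fun q hq hd => hm q hq (hq.dvd_of_dvd_card_of_nsmul_eq_zero (fun x => ?_) hd),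
    fun q hq hd => hm q hq (hq.dvd_of_dvd_card_of_nsmul_eq_zero (fun x => ?_) hd), ?_⟩
  · induction x using QuotientAddGroup.induction_on with
    | H y =>
      obtain ⟨x, hx⟩ := hcoker y
      rw [← QuotientAddGroup.mk_nsmul, QuotientAddGroup.eq_zero_iff]
      exact ⟨x, hx⟩
  · exact Subtype.ext (hker x x.2)
  · rw [AddSubgroup.card_eq_card_quotient_mul_card_addSubgroup f.range,
      AddSubgroup.card_eq_card_quotient_mul_card_addSubgroup f.ker,
      Nat.card_congr (QuotientAddGroup.quotientKerEquivRange f).toEquiv]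
    ring

theorem Nat.Prime.dvd_exponent_of_dvd_card {G : Type*} [Group G] [Finite G] {q : ℕ} (hq : q.Prime)
    (h : q ∣ Nat.card G) : q ∣ Monoid.exponent G := by
  have := Fact.mk hq
  obtain ⟨x, hx⟩ := exists_prime_orderOf_dvd_card' q h
  exact hx ▸ Monoid.order_dvd_exponent x

section Characters

variable {R G M : Type*} [CommRing R] [CommGroup G] [Fintype G] [AddCommGroup M] [Module R M]

/-- The quasi-idempotent `∑ χ(σ)⁻¹ σ` of a representation. -/
noncomputable def charSum (ρ : G →* Module.End R M) (χ : G →* R) : Module.End R M :=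
  ∑ σ : G, χ σ⁻¹ • ρ σ

theorem rho_mul_charSum (ρ : G →* Module.End R M) (χ : G →* R) (τ : G) :
    ρ τ * charSum ρ χ = χ τ • charSum ρ χ := by
  rw [charSum, Finset.mul_sum, Finset.smul_sum]
  refine Fintype.sum_equiv (Equiv.mulLeft τ) _ _ fun σ => ?_
  rw [Equiv.coe_mulLeft, mul_smul_comm, ← map_mul, smul_smul, ← map_mul, mul_inv_rev,
    mul_comm σ⁻¹, mul_inv_cancel_left]

theorem charSum_mul_charSum_self (ρ : G →* Module.End R M) (χ : G →* R) :
    charSum ρ χ * charSum ρ χ = (Nat.card G : R) • charSum ρ χ := by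
  conv_lhs => enter [1]; rw [charSum]
  simp only [Finset.sum_mul, smul_mul_assoc, rho_mul_charSum, smul_smul, ← map_mul,
    inv_mul_cancel, map_one, one_smul, Finset.sum_const, Finset.card_univ, Nat.card_eq_fintype_card,
    Nat.cast_smul_eq_nsmul]

theorem charSum_mul_charSum_of_ne [IsDomain R] (ρ : G →* Module.End R M) {ψ χ : G →* R}
    (h : ψ ≠ χ) : charSum ρ ψ * charSum ρ χ = 0 := by
  conv_lhs => enter [1]; rw [charSum]
  simp only [Finset.sum_mul, smul_mul_assoc, rho_mul_charSum, smul_smul]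
  rw [← Finset.sum_smul]
  let f : G →* R :=
    { toFun := fun σ => ψ σ⁻¹ * χ σ
      map_one' := by simp
      map_mul' := fun σ τ => by rw [mul_inv, map_mul, map_mul]; ring }
  have hf : f ≠ 1 := fun hf => h <| MonoidHom.ext fun σ => by
    have h1 : ψ σ⁻¹ * χ σ = 1 := DFunLike.congr_fun hf σ
    have h2 : ψ σ * ψ σ⁻¹ = 1 := by rw [← map_mul, mul_inv_cancel, map_one]
    calc ψ σ = ψ σ * (ψ σ⁻¹ * χ σ) := by rw [h1, mul_one]
      _ = χ σ := by rw [← mul_assoc, h2, one_mul]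
  have := sum_hom_units_eq_zero f hf
  change ∑ σ, ψ σ⁻¹ * χ σ = 0 at this
  rw [this, zero_smul]

instance [IsDomain R] : Finite (G →* R) :=
  Finite.of_equiv _ (MonoidHom.toHomUnitsMulEquiv (G := G) (M := R)).symm.toEquiv

theorem sum_monoidHom_apply [IsDomain R] [HasEnoughRootsOfUnity R (Monoid.exponent G)]
    [Fintype (G →* R)] [DecidableEq G] (σ : G) :
    ∑ χ : G →* R, χ σ = if σ = 1 then (Nat.card G : R) else 0 := by
  have := Fintype.ofFinite (G →* Rˣ)
  have hE : ∑ χ : G →* R, χ σ = ∑ χ : G →* Rˣ, (χ σ : R) :=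
    Fintype.sum_equiv MonoidHom.toHomUnitsMulEquiv.toEquiv _ _ fun χ => rfl
  split_ifs with h
  · subst h
    rw [hE, ← CommGroup.card_monoidHom_of_hasEnoughRootsOfUnity G R]
    simp
  · rw [hE]
    let f : (G →* Rˣ) →* R := (Units.coeHom R).comp (MonoidHom.eval σ)
    refine sum_hom_units_eq_zero f fun hf => ?_
    obtain ⟨φ, hφ⟩ := CommGroup.exists_apply_ne_one_of_hasEnoughRootsOfUnity G R h
    exact hφ (Units.ext (DFunLike.congr_fun hf φ))

theorem sum_charSum [IsDomain R] [HasEnoughRootsOfUnity R (Monoid.exponent G)]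
    [Fintype (G →* R)] (ρ : G →* Module.End R M) :
    ∑ χ : G →* R, charSum ρ χ = (Nat.card G : R) • 1 := by
  classical
  simp only [charSum]
  rw [Finset.sum_comm]
  simp only [← Finset.sum_smul, sum_monoidHom_apply, inv_eq_one, ite_smul, zero_smul,
    Finset.sum_ite_eq', Finset.mem_univ, if_true, map_one]

theorem eqUpToPrimesOf_card_prod_range_charSum [IsDomain R]
    [HasEnoughRootsOfUnity R (Monoid.exponent G)] [Fintype (G →* R)] [Finite M]
    (ρ : G →* Module.End R M) :
    EqUpToPrimesOf (Monoid.exponent G) (Nat.card M)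
      (∏ χ : G →* R, Nat.card (LinearMap.range (charSum ρ χ))) := by
  rw [← Nat.card_pi]
  refine AddMonoidHom.eqUpToPrimesOf_card
    (LinearMap.pi fun χ : G →* R => (charSum ρ χ).rangeRestrict).toAddMonoidHom
    (m := Nat.card G) (fun q hq h => hq.dvd_exponent_of_dvd_card h) (fun x hx => ?_) (fun y => ?_)
  · have hx' (χ : G →* R) : charSum ρ χ x = 0 := congrArg Subtype.val (congrFun hx χ)
    have := LinearMap.congr_fun (sum_charSum ρ) x
    simpa [LinearMap.sum_apply, hx', Nat.cast_smul_eq_nsmul] using this.symm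
  · choose z hz using fun χ => (y χ).2
    refine ⟨∑ χ, y χ, funext fun ψ => Subtype.ext ?_⟩
    change charSum ρ ψ (∑ χ, (y χ : M)) = Nat.card G • (y ψ : M)
    simp only [← hz, map_sum, ← Module.End.mul_apply]
    rw [Finset.sum_eq_single ψ (fun χ _ h => by rw [charSum_mul_charSum_of_ne ρ h.symm]; rfl)
      (by simp), charSum_mul_charSum_self, LinearMap.smul_apply, Nat.cast_smul_eq_nsmul]

end Characters

theorem isDomain_cycQuotRing {e : ℕ} (he : 0 < e) : IsDomain (CycQuotRing e) := by
  have hp : (Ideal.span {cyclotomic e ℤ}).IsPrime :=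
    (Ideal.span_singleton_prime (cyclotomic_ne_zero e ℤ)).mpr (cyclotomic.irreducible he).prime
  exact Ideal.Quotient.isDomain _

/-- The power basis `1, ζ, …, ζ^(φ(e)-1)` of `ℤ[X]/(Φ_e)`. -/
noncomputable def cycQuotRingBasis (e : ℕ) :
    Module.Basis (Fin (cyclotomic e ℤ).natDegree) ℤ (CycQuotRing e) :=
  (AdjoinRoot.powerBasis' (cyclotomic.monic e ℤ)).basis

theorem charZero_cycQuotRing {e : ℕ} (he : 0 < e) : CharZero (CycQuotRing e) := by
  have := isDomain_cycQuotRing he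
  have := Module.Free.of_basis (cycQuotRingBasis e)
  exact charZero_of_injective_algebraMap (FaithfulSMul.algebraMap_injective ℤ (CycQuotRing e))

theorem isPrimitiveRoot_zetaCyc {e : ℕ} (he : 0 < e) : IsPrimitiveRoot (zetaCyc e) e := by
  have := isDomain_cycQuotRing he
  have := charZero_cycQuotRing he
  have : NeZero (e : CycQuotRing e) := ⟨Nat.cast_ne_zero.mpr he.ne'⟩
  have h : aeval (zetaCyc e) (cyclotomic e ℤ) = 0 :=
    (AdjoinRoot.aeval_eq (f := cyclotomic e ℤ) _).trans AdjoinRoot.mk_self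
  rw [← isRoot_cyclotomic_iff, IsRoot, ← h, ← eval_map_algebraMap]
  congr 1
  exact (map_cyclotomic e _).symm

theorem hasEnoughRootsOfUnity_cycQuotRing {e : ℕ} (he : 0 < e) :
    HasEnoughRootsOfUnity (CycQuotRing e) e := by
  have := isDomain_cycQuotRing he
  have : NeZero e := ⟨he.ne'⟩
  exact ⟨⟨_, isPrimitiveRoot_zetaCyc he⟩, inferInstance⟩

/-- `R ⊗ A` as a power of `A`. -/
noncomputable def barClassGroupEquiv (e : ℕ) (A : Type*) [CommGroup A] :
    barClassGroup e A ≃ₗ[ℤ] (Fin (cyclotomic e ℤ).natDegree →₀ Additive A) :=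
  TensorProduct.equivFinsuppOfBasisLeft (cycQuotRingBasis e)

instance (e : ℕ) (A : Type*) [CommGroup A] [Finite A] : Finite (barClassGroup e A) :=
  have : Finite (Additive A) := ‹Finite A›
  Finite.of_equiv _ ((barClassGroupEquiv e A).toEquiv.trans Finsupp.equivFunOnFinite).symm

theorem card_barClassGroup (e : ℕ) (A : Type*) [CommGroup A] :
    Nat.card (barClassGroup e A) = Nat.card A ^ e.totient := by
  rw [Nat.card_congr ((barClassGroupEquiv e A).toEquiv.trans Finsupp.equivFunOnFinite),
    Nat.card_fun, Nat.card_fin, natDegree_cyclotomic]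
  rfl

theorem barEnd_one (e : ℕ) {A : Type*} [CommGroup A] : barEnd e (1 : Monoid.End A) = 1 :=
  LinearMap.baseChange_id

theorem barEnd_mul (e : ℕ) {A : Type*} [CommGroup A] (f g : Monoid.End A) :
    barEnd e (f * g) = barEnd e f * barEnd e g := by
  refine LinearMap.ext fun x => ?_
  induction x using TensorProduct.induction_on with
  | zero => rw [map_zero, map_zero]
  | add x y hx hy => rw [map_add, map_add, hx, hy]
  | tmul r x => rfl

/-- The representation on `R ⊗ A` of a group acting on `A`. -/
noncomputable def barRep (e : ℕ) {A G : Type*} [CommGroup A] [Group G] (ρ : G →* Monoid.End A) :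
    G →* Module.End (CycQuotRing e) (barClassGroup e A) where
  toFun σ := barEnd e (ρ σ)
  map_one' := by rw [map_one, barEnd_one]
  map_mul' σ τ := by rw [map_mul, barEnd_mul]

theorem epsBar_eq_charSum {A G : Type*} [CommGroup A] [CommGroup G] [Fintype G]
    (ρ : G →* Monoid.End A) (χ : G →* CycQuotRing (Monoid.exponent G)) :
    epsBar (Monoid.exponent G) (fun σ => ρ σ) χ = charSum (barRep _ ρ) χ := by
  unfold epsBar
  rw [finsum_eq_sum_of_fintype, charSum]
  refine Finset.sum_congr rfl fun σ _ => ?_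
  have h : σ ^ (Monoid.exponent G - 1) = σ⁻¹ := by
    rw [eq_inv_iff_mul_eq_one, ← pow_succ, Nat.sub_add_cancel
      (Nat.pos_of_ne_zero Monoid.exponent_ne_zero_of_finite), Monoid.pow_exponent_eq_one]
  rw [← h, map_pow]
  rfl

theorem exists_apply_eq_zetaCyc_pow {G : Type*} [Group G] [Finite G]
    (χ : G →* CycQuotRing (Monoid.exponent G)) (σ : G) :
    ∃ k : ℕ, χ σ = zetaCyc (Monoid.exponent G) ^ k := by
  have he : 0 < Monoid.exponent G := Nat.pos_of_ne_zero Monoid.exponent_ne_zero_of_finite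
  have := isDomain_cycQuotRing he
  have : NeZero (Monoid.exponent G) := ⟨he.ne'⟩
  obtain ⟨k, -, hk⟩ := (isPrimitiveRoot_zetaCyc he).eq_pow_of_pow_eq_one (ξ := χ σ)
    (by rw [← map_pow, Monoid.pow_exponent_eq_one, map_one])
  exact ⟨k, hk.symm⟩

theorem finprod_card_range_epsBar {A G : Type*} [CommGroup A] [CommGroup G] [Fintype G]
    [Fintype (G →* CycQuotRing (Monoid.exponent G))]
    (ρ : G →* Monoid.End A) :
    Nat.card (LinearMap.range (charSum (barRep (Monoid.exponent G) ρ) 1)) *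
      ∏ᶠ (χ : G →* CycQuotRing (Monoid.exponent G))
        (_ : (∀ σ, ∃ k : ℕ, χ σ = zetaCyc (Monoid.exponent G) ^ k) ∧ χ ≠ 1),
        Nat.card (LinearMap.range (epsBar (Monoid.exponent G) (fun σ => ρ σ) χ)) =
    ∏ χ, Nat.card (LinearMap.range (charSum (barRep (Monoid.exponent G) ρ) χ)) := by
  classical
  simp only [exists_apply_eq_zetaCyc_pow, implies_true, true_and, epsBar_eq_charSum]
  rw [← Finset.mul_prod_erase _ _ (Finset.mem_univ 1)]
  congr 1
  exact finprod_cond_eq_prod_of_cond_iff _ (by simp)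

/-- If `j : B → A` and `N : A → B` satisfy `j N = ∑ σ` and `N j = |G|`, then the image of `∑ σ` on
`R ⊗ A` agrees with a power of `|B|` up to the primes dividing the exponent of `G`. -/
theorem eqUpToPrimesOf_card_range_charSum_one {A B G : Type*} [CommGroup A] [CommGroup B]
    [Finite A] [Finite B] [CommGroup G] [Fintype G] (ρ : G →* Monoid.End A)
    (j : B →* A) (N : A →* B) (hjN : ∀ x, j (N x) = ∏ σ, ρ σ x)
    (hNj : ∀ y, N (j y) = y ^ Nat.card G) :
    EqUpToPrimesOf (Monoid.exponent G) (Nat.card B ^ (Monoid.exponent G).totient)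
      (Nat.card (LinearMap.range (charSum (barRep (Monoid.exponent G) ρ) 1))) := by
  rw [← card_barClassGroup]
  set e := Monoid.exponent G
  let j' := LinearMap.baseChange (CycQuotRing e) (MonoidHom.toAdditive j).toIntLinearMap
  let N' := LinearMap.baseChange (CycQuotRing e) (MonoidHom.toAdditive N).toIntLinearMap
  have hjN' (x) : j' (N' x) = charSum (barRep e ρ) 1 x := by
    induction x using TensorProduct.induction_on with
    | zero => simp
    | add x y hx hy => simp only [map_add, hx, hy]
    | tmul r x =>
      simp only [charSum, MonoidHom.one_apply, one_smul, LinearMap.sum_apply]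
      change r ⊗ₜ[ℤ] Additive.ofMul (j (N x.toMul)) =
        ∑ σ, r ⊗ₜ[ℤ] Additive.ofMul (ρ σ x.toMul)
      rw [hjN, ofMul_prod, TensorProduct.tmul_sum]
  have hNj' (y) : N' (j' y) = Nat.card G • y := by
    induction y using TensorProduct.induction_on with
    | zero => simp
    | add x y hx hy => simp only [map_add, hx, hy, smul_add]
    | tmul r y =>
      change r ⊗ₜ[ℤ] Additive.ofMul (N (j y.toMul)) = _
      rw [hNj, ofMul_pow, TensorProduct.tmul_smul]
      rfl
  refine AddMonoidHom.eqUpToPrimesOf_card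
    ((charSum (barRep e ρ) 1).rangeRestrict ∘ₗ j').toAddMonoidHom
    (m := Nat.card G ^ 2) (fun q hq h => hq.dvd_exponent_of_dvd_card (hq.dvd_of_dvd_pow h))
    (fun y hy => ?_) (fun z => ?_)
  · have hy' : charSum (barRep e ρ) 1 (j' y) = 0 := congrArg Subtype.val hy
    rw [pow_two, mul_smul, ← hNj', ← hNj', hjN', hy', map_zero]
  · obtain ⟨_, x, rfl⟩ := z
    refine ⟨Nat.card G • N' x, Subtype.ext ?_⟩
    change charSum (barRep e ρ) 1 (j' (Nat.card G • N' x)) =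
      Nat.card G ^ 2 • charSum (barRep e ρ) 1 x
    rw [map_nsmul, map_nsmul, hjN', ← Module.End.mul_apply, charSum_mul_charSum_self,
      LinearMap.smul_apply, Nat.cast_smul_eq_nsmul, smul_smul, pow_two]

theorem finrank_ringOfIntegers_eq_card_aut (F K : Type*) [Field F] [NumberField F] [Field K]
    [NumberField K] [Algebra F K] [IsGalois F K] :
    Module.finrank (𝓞 F) (𝓞 K) = Nat.card (K ≃ₐ[F] K) := by
  rw [← IsFractionRing.finrank_eq (𝓞 F) F (𝓞 K) K, ← IsGalois.card_aut_eq_finrank]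

theorem map_relNorm_le_prod_map_galRestrict (F K : Type*) [Field F] [NumberField F] [Field K]
    [NumberField K] [Algebra F K] [IsGalois F K] (I : Ideal (𝓞 K)) :
    (Ideal.relNorm (𝓞 F) I).map (algebraMap (𝓞 F) (𝓞 K)) ≤
      ∏ σ : K ≃ₐ[F] K, I.map (galRestrict (𝓞 F) F K (𝓞 K) σ) := by
  rw [Ideal.map_relNorm, Ideal.span_le]
  rintro _ ⟨x, hx, rfl⟩
  have h : algebraMap (𝓞 F) (𝓞 K) (Algebra.intNorm (𝓞 F) (𝓞 K) x) =
      ∏ σ : K ≃ₐ[F] K, galRestrict (𝓞 F) F K (𝓞 K) σ x := by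
    rw [prod_galRestrict_eq_norm]
    congr 1
    apply FaithfulSMul.algebraMap_injective (𝓞 F) F
    rw [Algebra.algebraMap_intNorm (L := K), IsIntegralClosure.algebraMap_mk']
  change algebraMap (𝓞 F) (𝓞 K) (Algebra.intNorm (𝓞 F) (𝓞 K) x) ∈ _
  rw [h]
  exact Ideal.prod_mem_prod fun σ _ => Ideal.mem_map_of_mem _ hx

theorem map_relNorm_eq_prod_map_galRestrict (F K : Type*) [Field F] [NumberField F] [Field K]
    [NumberField K] [Algebra F K] [IsGalois F K] (I : Ideal (𝓞 K)) :
    (Ideal.relNorm (𝓞 F) I).map (algebraMap (𝓞 F) (𝓞 K)) =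
      ∏ σ : K ≃ₐ[F] K, I.map (galRestrict (𝓞 F) F K (𝓞 K) σ) := by
  by_cases hI : I = ⊥
  · subst hI
    rw [Ideal.relNorm_bot, Ideal.map_bot]
    exact (Finset.prod_eq_zero (Finset.mem_univ 1) Ideal.map_bot).symm
  obtain ⟨J, hJ⟩ := Ideal.dvd_iff_le.mpr (map_relNorm_le_prod_map_galRestrict F K I)
  have hσ (σ : K ≃ₐ[F] K) :
      Ideal.absNorm (I.map (galRestrict (𝓞 F) F K (𝓞 K) σ)) = Ideal.absNorm I := by
    rw [← Ideal.absNorm_relNorm (𝓞 F), Ideal.relNorm_map_algEquiv, Ideal.absNorm_relNorm]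
  have hn := congrArg Ideal.absNorm hJ
  rw [map_mul, map_prod, Finset.prod_congr rfl fun σ _ => hσ σ, Finset.prod_const,
    Finset.card_univ, Ideal.absNorm_algebraMap, Ideal.absNorm_relNorm,
    finrank_ringOfIntegers_eq_card_aut F K,
    Nat.card_eq_fintype_card] at hn
  have hJ' : Ideal.absNorm J = 1 := Nat.eq_of_mul_eq_mul_left
    (pow_pos (Nat.pos_of_ne_zero (Ideal.absNorm_eq_zero_iff.not.mpr hI)) _)
    (hn.symm.trans (mul_one _).symm)
  rw [hJ, Ideal.absNorm_eq_one_iff.mp hJ', Ideal.mul_top]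

theorem exists_classGroup_relNorm (A B : Type*) [CommRing A] [CommRing B] [IsDedekindDomain A]
    [IsDedekindDomain B] [Algebra A B] [Module.Finite A B] [Module.IsTorsionFree A B] :
    ∃ N : ClassGroup B →* ClassGroup A, ∀ (I : (Ideal B)⁰) (J : (Ideal A)⁰),
      Ideal.relNorm A (I : Ideal B) = J → N (ClassGroup.mk0 I) = ClassGroup.mk0 J := by
  let n : (Ideal B)⁰ →* (Ideal A)⁰ :=
    { toFun := fun I => ⟨Ideal.relNorm A (I : Ideal B), mem_nonZeroDivisors_iff_ne_zero.mpr
        fun h => nonZeroDivisors.coe_ne_zero I (Ideal.relNorm_eq_bot_iff.mp h)⟩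
      map_one' := Subtype.ext (map_one _)
      map_mul' := fun I J => Subtype.ext (map_mul _ _ _) }
  have hn (I J : (Ideal B)⁰) (h : ClassGroup.mk0 I = ClassGroup.mk0 J) :
      ClassGroup.mk0 (n I) = ClassGroup.mk0 (n J) := by
    rw [ClassGroup.mk0_eq_mk0_iff] at h ⊢
    obtain ⟨x, y, hx, hy, h⟩ := h
    refine ⟨Algebra.intNorm A B x, Algebra.intNorm A B y, Algebra.intNorm_ne_zero.mpr hx,
      Algebra.intNorm_ne_zero.mpr hy, ?_⟩
    change _ * Ideal.relNorm A (I : Ideal B) = _ * Ideal.relNorm A (J : Ideal B)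
    rw [← Ideal.relNorm_singleton, ← Ideal.relNorm_singleton, ← map_mul, h, map_mul]
  choose s hs using ClassGroup.mk0_surjective (R := B)
  refine ⟨⟨⟨fun c => ClassGroup.mk0 (n (s c)), ?_⟩, fun c d => ?_⟩, fun I J hIJ => ?_⟩
  · rw [hn (s 1) 1 (by rw [hs, map_one]), map_one, map_one]
  · change ClassGroup.mk0 (n (s (c * d))) = ClassGroup.mk0 (n (s c)) * ClassGroup.mk0 (n (s d))
    rw [hn (s (c * d)) (s c * s d) (by rw [hs, map_mul, hs, hs]), map_mul, map_mul]
  · change ClassGroup.mk0 (n (s (ClassGroup.mk0 I))) = _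
    rw [hn _ I (hs _)]
    exact congrArg _ (Subtype.ext hIJ)

theorem eqUpToPrimesOf_card_prod_range_epsBar {A B G : Type*} [CommGroup A] [CommGroup B]
    [Finite A] [Finite B] [CommGroup G] [Fintype G] (ρ : G →* Monoid.End A)
    (j : B →* A) (N : A →* B) (hjN : ∀ x, j (N x) = ∏ σ, ρ σ x)
    (hNj : ∀ y, N (j y) = y ^ Nat.card G) :
    EqUpToPrimesOf (Monoid.exponent G) (Nat.card A ^ (Monoid.exponent G).totient)
      (Nat.card B ^ (Monoid.exponent G).totient *
        ∏ᶠ (χ : G →* CycQuotRing (Monoid.exponent G))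
          (_ : (∀ σ, ∃ k : ℕ, χ σ = zetaCyc (Monoid.exponent G) ^ k) ∧ χ ≠ 1),
          Nat.card (LinearMap.range (epsBar (Monoid.exponent G) (fun σ => ρ σ) χ))) := by
  have he : 0 < Monoid.exponent G := Nat.pos_of_ne_zero Monoid.exponent_ne_zero_of_finite
  have := isDomain_cycQuotRing he
  have := hasEnoughRootsOfUnity_cycQuotRing he
  have := Fintype.ofFinite (G →* CycQuotRing (Monoid.exponent G))
  have h := eqUpToPrimesOf_card_prod_range_charSum (barRep (Monoid.exponent G) ρ)
  rw [card_barClassGroup, ← finprod_card_range_epsBar] at h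
  exact h.trans ((eqUpToPrimesOf_card_range_charSum_one ρ j N hjN hNj).symm.mul_right _)

theorem map_galRestrict_mem_nonZeroDivisors {F K : Type*} [Field F] [NumberField F] [Field K]
    [NumberField K] [Algebra F K] (σ : K ≃ₐ[F] K) (I : (Ideal (𝓞 K))⁰) :
    (I : Ideal (𝓞 K)).map (galRestrict (𝓞 F) F K (𝓞 K) σ) ∈ (Ideal (𝓞 K))⁰ :=
  mem_nonZeroDivisors_iff_ne_zero.mpr fun h => nonZeroDivisors.coe_ne_zero I <|
    (Ideal.map_eq_bot_iff_of_injective (galRestrict (𝓞 F) F K (𝓞 K) σ).injective).mp h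

/-- The action on ideal classes pinned down by the action on ideals, as a representation. -/
theorem exists_monoidHom_eq_act (F K : Type*) [Field F] [NumberField F] [Field K] [NumberField K]
    [Algebra F K] (act : (K ≃ₐ[F] K) → (ClassGroup (𝓞 K) →* ClassGroup (𝓞 K)))
    (hact : ∀ (σ : K ≃ₐ[F] K) (I J : (Ideal (𝓞 K))⁰),
      Ideal.map (galRestrict (𝓞 F) F K (𝓞 K) σ) (I : Ideal (𝓞 K)) = (J : Ideal (𝓞 K)) →
        act σ (ClassGroup.mk0 I) = ClassGroup.mk0 J) :
    ∃ ρ : (K ≃ₐ[F] K) →* Monoid.End (ClassGroup (𝓞 K)), ∀ σ, ρ σ = act σ := by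
  refine ⟨⟨⟨act, ?_⟩, fun σ τ => ?_⟩, fun σ => rfl⟩
  · refine MonoidHom.ext fun c => ?_
    obtain ⟨I, rfl⟩ := ClassGroup.mk0_surjective c
    refine hact 1 I I ?_
    rw [map_one]
    exact Ideal.map_id _
  · refine MonoidHom.ext fun c => ?_
    obtain ⟨I, rfl⟩ := ClassGroup.mk0_surjective c
    change act (σ * τ) _ = act σ (act τ _)
    rw [hact τ I ⟨_, map_galRestrict_mem_nonZeroDivisors τ I⟩ rfl,
      hact σ _ ⟨_, map_galRestrict_mem_nonZeroDivisors σ _⟩ rfl]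
    refine hact _ _ _ ?_
    rw [map_mul]
    exact (Ideal.map_map (galRestrict (𝓞 F) F K (𝓞 K) τ).toRingHom
      (galRestrict (𝓞 F) F K (𝓞 K) σ).toRingHom).symm

/-- **Theorem 6.1 (consequence, formula (8)).** Let `K/F` be a finite abelian extension of
number fields with Galois group `G` of exponent `e`, let `R = ℤ[X]/(Φ_e)` with `ζ` the class
of `X`, and let `C̄_K = R ⊗_ℤ C_K` (with `G` acting through its natural action on ideal
classes, pinned down by `hact`).  Then there are positive integers `a, b`, divisible only by
primes dividing `e`, with `a ⬝ h_K^{φ(e)} = b ⬝ h_F^{φ(e)} ⬝ ∏_{χ ∈ Ĝ, χ ≠ 1} [ε_χ C̄_K]`. -/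
theorem exists_classNumber_pow_totient_eq_prod_eps_abelian
    (F K : Type*) [Field F] [NumberField F] [Field K] [NumberField K]
    [Algebra F K] [IsGalois F K]
    (hab : ∀ σ τ : K ≃ₐ[F] K, σ * τ = τ * σ)
    (act : (K ≃ₐ[F] K) → (ClassGroup (𝓞 K) →* ClassGroup (𝓞 K)))
    (hact : ∀ (σ : K ≃ₐ[F] K) (I J : (Ideal (𝓞 K))⁰),
      Ideal.map (galRestrict (𝓞 F) F K (𝓞 K) σ) (I : Ideal (𝓞 K)) = (J : Ideal (𝓞 K)) →
        act σ (ClassGroup.mk0 I) = ClassGroup.mk0 J) :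
    ∃ a b : ℕ, 0 < a ∧ 0 < b ∧
      (∀ q : ℕ, q.Prime → q ∣ a → q ∣ Monoid.exponent (K ≃ₐ[F] K)) ∧
      (∀ q : ℕ, q.Prime → q ∣ b → q ∣ Monoid.exponent (K ≃ₐ[F] K)) ∧
      a * Nat.card (ClassGroup (𝓞 K)) ^ (Monoid.exponent (K ≃ₐ[F] K)).totient =
        b * Nat.card (ClassGroup (𝓞 F)) ^ (Monoid.exponent (K ≃ₐ[F] K)).totient *
          ∏ᶠ (χ : (K ≃ₐ[F] K) →* CycQuotRing (Monoid.exponent (K ≃ₐ[F] K)))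
            (_ : (∀ σ, ∃ k : ℕ, χ σ = zetaCyc (Monoid.exponent (K ≃ₐ[F] K)) ^ k) ∧ χ ≠ 1),
            Nat.card
              (LinearMap.range (epsBar (Monoid.exponent (K ≃ₐ[F] K)) act χ)) := by
  obtain ⟨ρ, hρ⟩ := exists_monoidHom_eq_act F K act hact
  obtain rfl : act = fun σ => ρ σ := (funext hρ).symm
  obtain ⟨N, hN⟩ := exists_classGroup_relNorm (𝓞 F) (𝓞 K)
  have hne (I : (Ideal (𝓞 K))⁰) : Ideal.relNorm (𝓞 F) (I : Ideal (𝓞 K)) ∈ (Ideal (𝓞 F))⁰ :=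
    mem_nonZeroDivisors_iff_ne_zero.mpr
      fun h => nonZeroDivisors.coe_ne_zero I (Ideal.relNorm_eq_bot_iff.mp h)
  have hjN (x) : ClassGroup.extendedHom (𝓞 F) (𝓞 K) (N x) = ∏ σ, ρ σ x := by
    obtain ⟨I, rfl⟩ := ClassGroup.mk0_surjective x
    rw [hN I ⟨_, hne I⟩ rfl, ClassGroup.extendedHom_mk0]
    refine Eq.trans ?_ (Finset.prod_congr rfl fun σ _ =>
      (hact σ I ⟨_, map_galRestrict_mem_nonZeroDivisors σ I⟩ rfl).symm)
    rw [← map_prod]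
    refine congrArg _ (Subtype.ext ?_)
    rw [Submonoid.coe_finsetProd]
    exact map_relNorm_eq_prod_map_galRestrict F K I
  have hNj (y) : N (ClassGroup.extendedHom (𝓞 F) (𝓞 K) y) = y ^ Nat.card (K ≃ₐ[F] K) := by
    obtain ⟨J, rfl⟩ := ClassGroup.mk0_surjective y
    rw [ClassGroup.extendedHom_mk0, ← map_pow]
    refine hN _ _ ?_
    rw [Ideal.relNorm_algebraMap, finrank_ringOfIntegers_eq_card_aut F K]
    rfl
  let : CommGroup (K ≃ₐ[F] K) := { (inferInstance : Group (K ≃ₐ[F] K)) with mul_comm := hab }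
  obtain ⟨a, b, ha, hb, ha', hb', h⟩ := eqUpToPrimesOf_card_prod_range_epsBar ρ _ N hjN hNj
  exact ⟨a, b, ha, hb, ha', hb', h.trans (mul_assoc _ _ _).symm⟩
end
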